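/- Fix t>0 and n∈ℕ. (1) If a_n≠a_i for all 0≤i<n, then I_n(t;a_0,…,a_n) = e^{t a_n}·∏_{j=0}^{n−1} 1/(a_n−a_j) − Σ_{i=0}^{n−1} I_i(t;a_0,…,a_i)·∏_{j=i}^{n−1} 1/(a_n−a_j). Moreover, if a_0,…,a_n are pairwise distinct then I_n(t;a_0,…,a_n) = Σ_{i=0}^{n} e^{t a_i}·∏_{j≠i, 0≤j≤n} 1/(a_i−a_j). (2) I_n is a symmetric function of the variables (a_0,…,a_n). -/

import Mathlib

open MeasureTheory Filter

/-- The function `I_n(t; a_0,…,a_n)` of the paper: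
`I_n(t;a) = e^{t a_n} ∫_{ℝ₊^n} exp{Σ_{i<n} x_i(a_i−a_n)} 1{Σ_{i<n} x_i < t} dx`. -/
noncomputable def Ifun (n : ℕ) (t : ℝ) (a : Fin (n+1) → ℝ) : ℝ :=
  Real.exp (t * a (Fin.last n)) *
    ∫ x : Fin n → ℝ,
      Set.indicator {y : Fin n → ℝ | (∀ i, 0 ≤ y i) ∧ (∑ i, y i) < t}
        (fun y => Real.exp (∑ i, y i * (a i.castSucc - a (Fin.last n)))) x

/-- The solution at time `t` of `u' = a u + f`, `u 0 = 0`. -/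
noncomputable def expConv (a : ℝ) (f : ℝ → ℝ) (t : ℝ) : ℝ :=
  ∫ s in 0..t, Real.exp ((t - s) * a) * f s

theorem expConv_eq_exp_mul (a : ℝ) (f : ℝ → ℝ) (t : ℝ) :
    expConv a f t = Real.exp (t * a) * ∫ s in 0..t, Real.exp (-(s * a)) * f s := by
  rw [expConv, ← intervalIntegral.integral_const_mul]
  refine intervalIntegral.integral_congr fun s _ => ?_
  simp only [← mul_assoc, ← Real.exp_add]
  ring_nf

theorem hasDerivAt_expConv (a : ℝ) {f : ℝ → ℝ} (hf : Continuous f) (t : ℝ) :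
    HasDerivAt (expConv a f) (a * expConv a f t + f t) t := by
  have hc : Continuous fun s => Real.exp (-(s * a)) * f s := by fun_prop
  have h := ((hasDerivAt_mul_const a).exp (x := t)).mul
    (hc.integral_hasStrictDerivAt 0 t).hasDerivAt
  have he : expConv a f =
      (fun t => Real.exp (t * a)) * fun t => ∫ s in 0..t, Real.exp (-(s * a)) * f s :=
    funext (expConv_eq_exp_mul a f)
  rw [← he] at h
  refine h.congr_deriv ?_
  rw [expConv_eq_exp_mul, ← mul_assoc (Real.exp (t * a)) (Real.exp _), ← Real.exp_add,
    add_neg_cancel, Real.exp_zero]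
  ring

theorem continuous_expConv (a : ℝ) {f : ℝ → ℝ} (hf : Continuous f) :
    Continuous (expConv a f) :=
  continuous_iff_continuousAt.2 fun t => (hasDerivAt_expConv a hf t).continuousAt

theorem sub_mul_expConv_of_hasDerivAt (a b : ℝ) {f w : ℝ → ℝ} (hf : Continuous f)
    (hw : ∀ s, HasDerivAt w (b * w s + f s) s) (t : ℝ) :
    (a - b) * expConv a w t = expConv a f t - w t + Real.exp (t * a) * w 0 := by
  have hwc : Continuous w := continuous_iff_continuousAt.2 fun s => (hw s).continuousAt
  have hd : ∀ s, HasDerivAt (fun s => Real.exp (-(s * a)) * w s)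
      (Real.exp (-(s * a)) * f s - (a - b) * (Real.exp (-(s * a)) * w s)) s := fun s => by
    refine (((hasDerivAt_mul_const a (x := s)).fun_neg.exp).mul (hw s)).congr_deriv ?_
    ring
  have h := intervalIntegral.integral_eq_sub_of_hasDerivAt (a := 0) (b := t)
    (fun s _ => hd s) (Continuous.intervalIntegrable (by fun_prop) _ _)
  rw [intervalIntegral.integral_sub (Continuous.intervalIntegrable (by fun_prop) _ _)
    (Continuous.intervalIntegrable (by fun_prop) _ _),
    intervalIntegral.integral_const_mul] at h
  have hE : Real.exp (t * a) * Real.exp (-(t * a)) = 1 := by rw [← Real.exp_add]; simp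
  simp only [zero_mul, neg_zero, Real.exp_zero, one_mul] at h
  rw [expConv_eq_exp_mul, expConv_eq_exp_mul]
  linear_combination (-Real.exp (t * a)) * h - w t * hE

/-- The divided difference of `x ↦ exp (t * x)` at the nodes in a list. -/
noncomputable def expDivDiff : List ℝ → ℝ → ℝ
  | [], _ => 0
  | [a], t => Real.exp (t * a)
  | a :: b :: l, t => expConv a (expDivDiff (b :: l)) t

theorem continuous_expDivDiff : ∀ l : List ℝ, Continuous (expDivDiff l)
  | [] => continuous_const
  | [a] => by
    change Continuous fun t => Real.exp (t * a)
    fun_prop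
  | a :: b :: l => continuous_expConv a (continuous_expDivDiff (b :: l))

theorem sub_mul_expDivDiff_cons_cons (a b : ℝ) (l : List ℝ) (t : ℝ) :
    (a - b) * expDivDiff (a :: b :: l) t = expDivDiff (a :: l) t - expDivDiff (b :: l) t := by
  cases l with
  | nil =>
    have h := sub_mul_expConv_of_hasDerivAt a b (f := fun _ => 0)
      (w := fun s => Real.exp (s * b)) continuous_const (fun s => by
        convert (hasDerivAt_mul_const b (x := s)).exp using 1; ring) t
    have h0 : expConv a (fun _ => 0) t = 0 := by simp [expConv]
    rw [h0] at h
    simp only [expDivDiff, h]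
    simp
    ring
  | cons c l =>
    have hf := continuous_expDivDiff (c :: l)
    have h := sub_mul_expConv_of_hasDerivAt a b hf (hasDerivAt_expConv b hf) t
    have h0 : expConv b (expDivDiff (c :: l)) 0 = 0 := by simp [expConv]
    rw [h0] at h
    simp only [expDivDiff, h]
    ring

theorem expDivDiff_congr_perm {l l' : List ℝ} (h : l.Perm l') : expDivDiff l = expDivDiff l' := by
  induction h with
  | nil => rfl
  | cons a h ih =>
    rename_i l₁ l₂
    cases l₁ with
    | nil => rw [List.nil_perm.1 h]
    | cons b l₁ =>
      cases l₂ with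
      | nil => simp at h
      | cons c l₂ => funext t; simp only [expDivDiff, ih]
  | swap a b l =>
    rcases eq_or_ne a b with rfl | hab
    · rfl
    · funext t
      have h₁ := sub_mul_expDivDiff_cons_cons a b l t
      have h₂ := sub_mul_expDivDiff_cons_cons b a l t
      exact mul_left_cancel₀ (sub_ne_zero.2 hab) (by linear_combination - h₁ - h₂)
  | trans _ _ h₁ h₂ => exact h₁.trans h₂

theorem expDivDiff_cons_cons_of_ne {a b : ℝ} (hab : a ≠ b) (l : List ℝ) (t : ℝ) :
    expDivDiff (a :: b :: l) t =
      (a - b)⁻¹ * (expDivDiff (a :: l) t - expDivDiff (b :: l) t) := by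
  rw [← sub_mul_expDivDiff_cons_cons, inv_mul_cancel_left₀ (sub_ne_zero.2 hab)]

theorem expDivDiff_map_range_append (f : ℕ → ℝ) (b t : ℝ) (n : ℕ) (h : ∀ j < n, f j ≠ b) :
    expDivDiff ((List.range n).map f ++ [b]) t =
      Real.exp (t * b) * ∏ j ∈ Finset.range n, (b - f j)⁻¹ -
        ∑ i ∈ Finset.range n, expDivDiff ((List.range (i + 1)).map f) t *
          ∏ j ∈ Finset.range n, if i ≤ j then (b - f j)⁻¹ else 1 := by
  induction n with
  | zero => simp [expDivDiff]
  | succ n ih =>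
    have hp : ((List.range (n + 1)).map f ++ [b]).Perm (b :: f n :: (List.range n).map f) := by
      rw [List.range_succ, List.map_append, List.map_singleton]
      exact (List.perm_append_singleton _ _).trans ((List.perm_append_singleton _ _).cons b)
    have hp₁ : ((List.range (n + 1)).map f).Perm (f n :: (List.range n).map f) := by
      rw [List.range_succ, List.map_append, List.map_singleton]
      exact List.perm_append_singleton _ _
    rw [expDivDiff_congr_perm hp, expDivDiff_cons_cons_of_ne (h n n.lt_succ_self).symm,
      ← expDivDiff_congr_perm hp₁, ← expDivDiff_congr_perm (List.perm_append_singleton b _),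
      ih fun j hj => h j (hj.trans n.lt_succ_self), Finset.sum_range_succ]
    have hlast : (∏ j ∈ Finset.range (n + 1), if n ≤ j then (b - f j)⁻¹ else 1) =
        (b - f n)⁻¹ := by
      rw [Finset.prod_range_succ, Finset.prod_eq_one fun j hj => if_neg ?_]
      · simp
      · simpa using hj
    have hinit : ∀ i ∈ Finset.range n, expDivDiff ((List.range (i + 1)).map f) t *
          (∏ j ∈ Finset.range (n + 1), if i ≤ j then (b - f j)⁻¹ else 1) =
        (b - f n)⁻¹ * (expDivDiff ((List.range (i + 1)).map f) t *
          ∏ j ∈ Finset.range n, if i ≤ j then (b - f j)⁻¹ else 1) := fun i hi => by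
      rw [Finset.prod_range_succ, if_pos (Finset.mem_range.1 hi).le]
      ring
    rw [hlast, Finset.sum_congr rfl hinit, ← Finset.mul_sum, Finset.prod_range_succ]
    ring

theorem expDivDiff_map_of_injective {ι : Type*} [DecidableEq ι] {v : ι → ℝ}
    (hv : Function.Injective v) (t : ℝ) : ∀ {l : List ι}, l.Nodup →
    expDivDiff (l.map v) t =
      ∑ i ∈ l.toFinset, Real.exp (t * v i) * ∏ j ∈ l.toFinset.erase i, (v i - v j)⁻¹
  | [], _ => by simp [expDivDiff]
  | [i], _ => by simp [expDivDiff]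
  | i :: k :: l, hl => by
    have hi : (i :: l).Nodup := hl.sublist (by simp)
    have hk : (k :: l).Nodup := hl.sublist (by simp)
    have hik : i ≠ k := by rintro rfl; simp at hl
    have hvik : v i - v k ≠ 0 := sub_ne_zero.2 (hv.ne hik)
    have hil : i ∉ l.toFinset := by simpa using (List.nodup_cons.1 hi).1
    have hkl : k ∉ l.toFinset := by simpa using (List.nodup_cons.1 hk).1
    have hIi := expDivDiff_map_of_injective hv t hi
    have hIk := expDivDiff_map_of_injective hv t hk
    simp only [List.map_cons, List.toFinset_cons] at hIi hIk ⊢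
    rw [expDivDiff_cons_cons_of_ne (hv.ne hik), hIi, hIk]
    generalize l.toFinset = s at *
    have hiks : i ∉ insert k s := by simp [hik, hil]
    rw [Finset.sum_insert hil, Finset.sum_insert hkl, Finset.sum_insert hiks,
      Finset.sum_insert hkl, Finset.erase_insert hil, Finset.erase_insert hkl,
      Finset.erase_insert hiks, Finset.prod_insert hkl,
      Finset.insert_comm, Finset.erase_insert (by simp [hik.symm, hkl]), Finset.prod_insert hil]
    have hs : ∑ c ∈ s, Real.exp (t * v c) * ∏ j ∈ (insert k (insert i s)).erase c, (v c - v j)⁻¹ =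
        (v i - v k)⁻¹ * (∑ c ∈ s, Real.exp (t * v c) * ∏ j ∈ (insert i s).erase c, (v c - v j)⁻¹ -
          ∑ c ∈ s, Real.exp (t * v c) * ∏ j ∈ (insert k s).erase c, (v c - v j)⁻¹) := by
      rw [← Finset.sum_sub_distrib, Finset.mul_sum]
      refine Finset.sum_congr rfl fun c hc => ?_
      have hci : c ≠ i := fun h => hil (h ▸ hc)
      have hck : c ≠ k := fun h => hkl (h ▸ hc)
      have hvi : v c - v i ≠ 0 := sub_ne_zero.2 (hv.ne hci)
      have hvk : v c - v k ≠ 0 := sub_ne_zero.2 (hv.ne hck)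
      rw [Finset.erase_insert_of_ne hck.symm, Finset.erase_insert_of_ne hci.symm,
        Finset.erase_insert_of_ne hck.symm, Finset.prod_insert (by simp [hik.symm, hkl]),
        Finset.prod_insert (by simp [hil]), Finset.prod_insert (by simp [hkl])]
      field_simp
      ring
    rw [hs, ← neg_sub (v i) (v k), inv_neg]
    ring

theorem Ifun_zero {t : ℝ} (ht : 0 < t) (a : Fin 1 → ℝ) : Ifun 0 t a = Real.exp (t * a 0) := by
  simp [Ifun, ht, Measure.real, volume_pi]

theorem integrable_simplex_indicator (n : ℕ) (t : ℝ) (c : Fin n → ℝ) :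
    Integrable (Set.indicator {y : Fin n → ℝ | (∀ i, 0 ≤ y i) ∧ ∑ i, y i < t}
      fun y => Real.exp (∑ i, y i * c i)) := by
  have hm : MeasurableSet {y : Fin n → ℝ | (∀ i, 0 ≤ y i) ∧ ∑ i, y i < t} := by
    measurability
  rw [integrable_indicator_iff hm]
  have hc : Continuous fun y : Fin n → ℝ => Real.exp (∑ i, y i * c i) := by fun_prop
  refine (hc.continuousOn.integrableOn_compact (isCompact_Icc (a := 0) (b := fun _ => t))).mono_set
    fun y hy => ⟨hy.1, fun i => ?_⟩
  exact (Finset.single_le_sum (fun j _ => hy.1 j) (Finset.mem_univ i)).trans hy.2.le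

theorem Ifun_succ (n : ℕ) {t : ℝ} (ht : 0 < t) (a : Fin (n + 2) → ℝ) :
    Ifun (n + 1) t a = ∫ s in 0..t, Real.exp (s * a 0) * Ifun n (t - s) (fun i => a i.succ) := by
  have hmp := (volume_preserving_piFinSuccAbove (fun _ : Fin (n + 1) => ℝ) 0).symm
  have hemb := (MeasurableEquiv.piFinSuccAbove (fun _ : Fin (n + 1) => ℝ) 0).symm.measurableEmbedding
  have hI := integrable_simplex_indicator (n + 1) t
    (fun i => a i.castSucc - a (Fin.last (n + 1)))
  have hI' := (hmp.integrable_comp_emb hemb).2 hI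
  rw [Measure.volume_eq_prod] at hI'
  have hprod := integral_prod _ hI'
  rw [← Measure.volume_eq_prod] at hprod
  simp only [Function.comp_apply] at hprod
  rw [Ifun, ← hmp.integral_comp hemb, hprod,
    intervalIntegral.integral_of_le ht.le, ← integral_Icc_eq_integral_Ioc,
    ← integral_indicator measurableSet_Icc, ← integral_const_mul]
  refine integral_congr_ae (.of_forall fun s => ?_)
  have hcons : ∀ y : Fin n → ℝ,
      (MeasurableEquiv.piFinSuccAbove (fun _ : Fin (n + 1) => ℝ) 0).symm (s, y) =
        (Fin.cons s y : Fin (n + 1) → ℝ) := fun y => Fin.insertNth_zero' s y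
  simp only [hcons]
  by_cases hs : s ∈ Set.Icc 0 t
  · simp only [Set.indicator_of_mem hs, Ifun]
    rw [← mul_assoc, ← Real.exp_add, ← integral_const_mul, ← integral_const_mul]
    refine integral_congr_ae (.of_forall fun y => ?_)
    by_cases hy : (∀ i, 0 ≤ y i) ∧ ∑ i, y i < t - s
    · simp only [Set.indicator, Set.mem_ofPred_eq, Fin.forall_fin_succ, Fin.sum_univ_succ,
        Fin.cons_zero, Fin.cons_succ, hs.1, hy, true_and, lt_sub_iff_add_lt'.1 hy.2, if_true,
        implies_true, ← Real.exp_add, Fin.succ_last, Fin.castSucc_zero, Fin.succ_castSucc]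
      ring_nf
    · have hy' : ¬((0 ≤ s ∧ ∀ i, 0 ≤ y i) ∧ s + ∑ i, y i < t) := fun h =>
        hy ⟨h.1.2, lt_sub_iff_add_lt'.2 h.2⟩
      simp only [Set.indicator, Set.mem_ofPred_eq, Fin.forall_fin_succ, Fin.sum_univ_succ,
        Fin.cons_zero, Fin.cons_succ, hy, hy', if_false, mul_zero]
  · have hy : ∀ y : Fin n → ℝ, ¬((0 ≤ s ∧ ∀ i, 0 ≤ y i) ∧ s + ∑ i, y i < t) := fun y h =>
      hs ⟨h.1.1, (le_add_of_nonneg_right (Finset.sum_nonneg fun i _ => h.1.2 i)).trans h.2.le⟩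
    simp only [Set.indicator, hs, Set.mem_ofPred_eq, Fin.forall_fin_succ, Fin.sum_univ_succ,
      Fin.cons_zero, Fin.cons_succ, hy, if_false, integral_zero, mul_zero]

theorem Ifun_eq_expDivDiff (n : ℕ) {t : ℝ} (ht : 0 < t) (a : Fin (n + 1) → ℝ) :
    Ifun n t a = expDivDiff (List.ofFn a) t := by
  induction n generalizing t with
  | zero => simp [Ifun_zero ht, expDivDiff]
  | succ n ih =>
    rw [Ifun_succ n ht]
    have h : expDivDiff (List.ofFn a) t =
        expConv (a 0) (expDivDiff (List.ofFn fun i => a i.succ)) t := by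
      simp [List.ofFn_succ, expDivDiff]
    have hsub := intervalIntegral.integral_comp_sub_left (a := 0) (b := t) (fun s =>
      Real.exp ((t - s) * a 0) * expDivDiff (List.ofFn fun i => a i.succ) s) t
    rw [sub_self, sub_zero] at hsub
    rw [h, expConv, ← hsub]
    simp only [intervalIntegral.integral_of_le ht.le, integral_Ioc_eq_integral_Ioo]
    refine setIntegral_congr_fun measurableSet_Ioo fun s hs => ?_
    simp only [sub_sub_cancel, ih (sub_pos.2 hs.2)]

theorem List.map_range_eq_ofFn {α : Type*} (f : ℕ → α) (n : ℕ) :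
    (List.range n).map f = List.ofFn fun i : Fin n => f i := by
  apply List.ext_getElem <;> simp

/-- Lemma `bounds`.  (1) If `a_n ≠ a_i` for all `i < n` then
`I_n(t;a) = e^{t a_n}·∏_{j<n} (a_n−a_j)⁻¹ − Σ_{i<n} I_i(t;a_0,…,a_i)·∏_{j=i}^{n−1} (a_n−a_j)⁻¹`;
moreover if `a_0,…,a_n` are pairwise distinct then
`I_n(t;a) = Σ_{i≤n} e^{t a_i}·∏_{j≠i} (a_i−a_j)⁻¹`.
(2) `I_n` is a symmetric function of `(a_0,…,a_n)`. -/
theorem statement9 (n : ℕ) (t : ℝ) (ht : 0 < t) :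
    (∀ a : Fin (n+1) → ℝ,
      (∀ i : Fin (n+1), i ≠ Fin.last n → a i ≠ a (Fin.last n)) →
      Ifun n t a
        = Real.exp (t * a (Fin.last n)) * (∏ j : Fin n, (a (Fin.last n) - a j.castSucc)⁻¹)
          - ∑ i : Fin n,
              Ifun i.val t (fun k => a (Fin.castLE (Nat.succ_le_succ i.isLt.le) k)) *
                ∏ j : Fin n,
                  if i.val ≤ j.val then (a (Fin.last n) - a j.castSucc)⁻¹ else 1)
    ∧ (∀ a : Fin (n+1) → ℝ, Function.Injective a →
      Ifun n t a = ∑ i : Fin (n+1), Real.exp (t * a i) *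
        ∏ j : Fin (n+1), if j ≠ i then (a i - a j)⁻¹ else 1)
    ∧ (∀ a : Fin (n+1) → ℝ, ∀ e : Equiv.Perm (Fin (n+1)),
        Ifun n t (a ∘ e) = Ifun n t a) := by
  refine ⟨fun a ha => ?_, fun a ha => ?_, fun a e => ?_⟩
  · let f : ℕ → ℝ := fun k => a (Fin.ofNat (n + 1) k)
    have hf : ∀ (i : Fin (n + 1)), f i = a i := fun i => by simp [f]
    have hfc : ∀ (i : Fin n), f i = a i.castSucc := fun i => hf i.castSucc
    have hfl : ∀ (m : ℕ) (hm : m + 1 ≤ n + 1) (i : Fin (m + 1)), f i = a (Fin.castLE hm i) :=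
      fun m hm i => hf (Fin.castLE hm i)
    have h := expDivDiff_map_range_append f (a (Fin.last n)) t n fun j hj => by
      rw [hfc ⟨j, hj⟩]
      exact ha _ (Fin.castSucc_lt_last _).ne
    have hl : (List.range n).map f ++ [a (Fin.last n)] = List.ofFn a := by
      rw [List.map_range_eq_ofFn, List.ofFn_succ_last]
      simp only [hfc]
    rw [hl] at h
    simp only [List.map_range_eq_ofFn, Finset.prod_range, Finset.sum_range, hfc] at h
    rw [Ifun_eq_expDivDiff n ht, h]
    congr 1
    refine Finset.sum_congr rfl fun i _ => ?_
    rw [Ifun_eq_expDivDiff i ht]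
    simp only [hfl i (Nat.succ_le_succ i.isLt.le)]
  · have hu : (List.finRange (n + 1)).toFinset = Finset.univ := by ext; simp
    rw [Ifun_eq_expDivDiff n ht, List.ofFn_eq_map,
      expDivDiff_map_of_injective ha t (List.nodup_finRange _), hu]
    refine Finset.sum_congr rfl fun i _ => ?_
    rw [← Finset.prod_filter, Finset.filter_ne']
  · rw [Ifun_eq_expDivDiff n ht, Ifun_eq_expDivDiff n ht,
      expDivDiff_congr_perm (e.ofFn_comp_perm a)]
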